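/- arXiv:2301.08791 — 9 statements merged into one kernel-verified Lean document; each statement's English description precedes it below -/
import Mathlib

section
/- One has $\lim_{s\to +\infty} \frac{(G^{-1}(s))^{\alpha}}{s} = 2^{1/p}$, and consequently $\lim_{s\to +\infty} \frac{G^{-1}(s)}{s} = 0$. -/
open Real Filter MeasureTheory

/-- The integrand `(1 + α^p/2 * z^(p(α-1)))^(1/p)` lies between `c * z^(α-1)` and
`1 + c * z^(α-1)`, with `c = α / 2^(1/p)`. -/
lemma rpow_one_add_bounds {p α z : ℝ} (hp : 1 < p) (hα : 1 < α) (hz : 0 ≤ z) :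
    α * (2 ^ (1 / p))⁻¹ * z ^ (α - 1) ≤ (1 + α ^ p / 2 * |z| ^ (p * (α - 1))) ^ (1 / p) ∧
      (1 + α ^ p / 2 * |z| ^ (p * (α - 1))) ^ (1 / p) ≤
        1 + α * (2 ^ (1 / p))⁻¹ * z ^ (α - 1) := by
  have hp0 : 0 < p := by linarith
  have hα0 : 0 ≤ α := by linarith
  have hx : 0 ≤ α ^ p / 2 * z ^ (p * (α - 1)) := by positivity
  have key : (α ^ p / 2 * z ^ (p * (α - 1))) ^ (1 / p) =
      α * (2 ^ (1 / p))⁻¹ * z ^ (α - 1) := by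
    rw [mul_rpow (by positivity) (by positivity), div_rpow (by positivity) (by norm_num),
      ← rpow_mul hα0, ← rpow_mul hz, mul_one_div_cancel hp0.ne', rpow_one, div_eq_mul_inv]
    congr 2
    field_simp
  rw [abs_of_nonneg hz, ← key]
  refine ⟨rpow_le_rpow hx (by linarith) (by positivity), ?_⟩
  have h := rpow_add_le_add_rpow (p := 1 / p) zero_le_one hx (by positivity)
    ((div_le_one hp0).2 hp.le)
  rwa [one_rpow] at h

/-- `lim_{s→+∞} (G⁻¹(s))^α/s = 2^(1/p)` and consequently
`lim_{s→+∞} G⁻¹(s)/s = 0`, where `g t = (1 + α^p/2 * |t|^(p(α-1)))^(1/p)`,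
`G t = ∫ z in 0..t, g z`, `p > 1`, `α > 1`, and `Ginv` is the inverse of `G`. -/
theorem stmt_3 (p α : ℝ) (hp : 1 < p) (hα : 1 < α)
    (g G Ginv : ℝ → ℝ)
    (hg : ∀ t : ℝ, g t = (1 + α ^ p / 2 * |t| ^ (p * (α - 1))) ^ (1 / p))
    (hG : ∀ t : ℝ, G t = ∫ z in (0 : ℝ)..t, g z)
    (hinv₁ : Function.LeftInverse Ginv G)
    (hinv₂ : Function.RightInverse Ginv G) :
    Tendsto (fun s : ℝ => (Ginv s) ^ α / s) atTop (nhds ((2 : ℝ) ^ (1 / p))) ∧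
    Tendsto (fun s : ℝ => Ginv s / s) atTop (nhds 0) := by
  have hp0 : 0 < p := by linarith
  have hα0 : 0 < α := by linarith
  set k : ℝ := (2 ^ (1 / p))⁻¹ with hk
  have hk0 : 0 < k := by positivity
  have hgc : Continuous g := by
    rw [funext hg]
    refine Continuous.rpow_const (continuous_const.add (continuous_const.mul
      (continuous_abs.rpow_const fun _ => Or.inr ?_))) fun _ => Or.inr (by positivity)
    exact mul_nonneg hp0.le (by linarith)
  have hpc : Continuous fun z : ℝ => α * k * z ^ (α - 1) :=
    continuous_const.mul (continuous_id.rpow_const fun _ => Or.inr (by linarith))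
  have hint (t : ℝ) : ∫ z in (0 : ℝ)..t, α * k * z ^ (α - 1) = k * t ^ α := by
    rw [intervalIntegral.integral_const_mul, integral_rpow (Or.inl (by linarith)),
      sub_add_cancel, zero_rpow hα0.ne']
    field_simp
    ring
  have lower {t : ℝ} (ht : 0 ≤ t) : k * t ^ α ≤ G t := by
    rw [hG, ← hint]
    refine intervalIntegral.integral_mono_on ht (hpc.intervalIntegrable _ _)
      (hgc.intervalIntegrable _ _) fun z hz => ?_
    rw [hg]
    exact (rpow_one_add_bounds hp hα hz.1).1
  have upper {t : ℝ} (ht : 0 ≤ t) : G t ≤ t + k * t ^ α := by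
    have hsum : ∫ z in (0 : ℝ)..t, (1 + α * k * z ^ (α - 1)) = t + k * t ^ α := by
      rw [intervalIntegral.integral_add (continuous_const.intervalIntegrable _ _)
        (hpc.intervalIntegrable _ _), hint]
      simp
    rw [hG, ← hsum]
    refine intervalIntegral.integral_mono_on ht (hgc.intervalIntegrable _ _)
      ((continuous_const.add hpc).intervalIntegrable _ _) fun z hz => ?_
    rw [hg]
    exact (rpow_one_add_bounds hp hα hz.1).2
  have nonpos {t : ℝ} (ht : t ≤ 0) : G t ≤ 0 := by
    rw [hG, intervalIntegral.integral_symm, neg_nonpos]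
    refine intervalIntegral.integral_nonneg ht fun z _ => ?_
    rw [hg]
    positivity
  have hGinv : Tendsto Ginv atTop atTop := by
    refine tendsto_atTop.2 fun M => ?_
    filter_upwards [eventually_gt_atTop (M + k * M ^ α), eventually_gt_atTop 0] with s hs hs0
    by_contra! hlt
    have hs' : G (Ginv s) = s := hinv₂ s
    rcases le_total (Ginv s) 0 with h | h
    · linarith [nonpos h]
    · have h1 := upper h
      have h2 : k * Ginv s ^ α ≤ k * M ^ α := by gcongr
      linarith
  have hdecay : Tendsto (fun t : ℝ => t ^ (1 - α)) atTop (nhds 0) := by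
    simpa using tendsto_rpow_neg_atTop (show 0 < α - 1 by linarith)
  have hratio : Tendsto (fun t : ℝ => G t / t ^ α) atTop (nhds k) := by
    have hup : Tendsto (fun t : ℝ => t ^ (1 - α) + k) atTop (nhds k) := by
      simpa using hdecay.add_const k
    refine tendsto_of_tendsto_of_tendsto_of_le_of_le' tendsto_const_nhds hup ?_ ?_
    · filter_upwards [eventually_gt_atTop 0] with t ht
      rw [le_div_iff₀ (by positivity)]
      exact lower ht.le
    · filter_upwards [eventually_gt_atTop 0] with t ht
      rw [div_le_iff₀ (by positivity), add_mul, ← rpow_add ht, sub_add_cancel, rpow_one]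
      exact upper ht.le
  have hmain : Tendsto (fun s : ℝ => (Ginv s) ^ α / s) atTop (nhds ((2 : ℝ) ^ (1 / p))) := by
    have h := (hratio.comp hGinv).inv₀ hk0.ne'
    rw [hk, inv_inv] at h
    refine h.congr fun s => ?_
    rw [Function.comp_apply, hinv₂ s, inv_div]
  refine ⟨hmain, ?_⟩
  have h := hmain.mul (hdecay.comp hGinv)
  rw [mul_zero] at h
  refine h.congr' ?_
  filter_upwards [hGinv.eventually_gt_atTop 0] with s hs
  rw [Function.comp_apply, div_mul_eq_mul_div, ← rpow_add hs, add_sub_cancel, rpow_one]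
end

section
/- For every $t\ne 0$ the function $g$ is differentiable at $t$ and $\frac{t\,g'(t)}{g(t)} = (\alpha-1)\,\frac{\alpha^p |t|^{p(\alpha-1)}}{2+\alpha^p |t|^{p(\alpha-1)}}$; in particular $0 \le \frac{t\,g'(t)}{g(t)} < \alpha - 1$ for every $t\ne 0$. -/
open Real Filter

theorem hasDerivAt_abs_rpow_of_ne_zero {t : ℝ} (q : ℝ) (ht : t ≠ 0) :
    HasDerivAt (fun x : ℝ => |x| ^ q) (q * |t| ^ q / t) t := by
  have h := (hasDerivAt_abs ht).rpow_const (p := q) (Or.inl (abs_ne_zero.mpr ht))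
  convert h using 1
  rw [Real.rpow_sub_one (abs_ne_zero.mpr ht)]
  rcases lt_or_gt_of_ne ht with h0 | h0
  · simp [abs_of_neg h0, sign_neg h0]
    field_simp
  · simp [abs_of_pos h0, sign_pos h0]
    field_simp

/-- For every `t ≠ 0`, `g` is differentiable at `t` and
`t g'(t) / g(t) = (α-1) · α^p |t|^(p(α-1)) / (2 + α^p |t|^(p(α-1)))`;
in particular `0 ≤ t g'(t)/g(t) < α - 1`.  Here
`g t = (1 + α^p/2 * |t|^(p(α-1)))^(1/p)`, `p > 1`, `α > 1`. -/
theorem stmt_5 (p α : ℝ) (hp : 1 < p) (hα : 1 < α)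
    (g : ℝ → ℝ)
    (hg : ∀ t : ℝ, g t = (1 + α ^ p / 2 * |t| ^ (p * (α - 1))) ^ (1 / p)) :
    ∀ t : ℝ, t ≠ 0 →
      DifferentiableAt ℝ g t ∧
      t * deriv g t / g t =
        (α - 1) * (α ^ p * |t| ^ (p * (α - 1)) / (2 + α ^ p * |t| ^ (p * (α - 1)))) ∧
      0 ≤ t * deriv g t / g t ∧ t * deriv g t / g t < α - 1 := by
  intro t ht
  obtain rfl : g = fun t => (1 + α ^ p / 2 * |t| ^ (p * (α - 1))) ^ (1 / p) := funext hg
  have hA : 0 < α ^ p * |t| ^ (p * (α - 1)) :=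
    mul_pos (Real.rpow_pos_of_pos (by linarith) _) (Real.rpow_pos_of_pos (abs_pos.mpr ht) _)
  have hB : 0 < 1 + α ^ p / 2 * |t| ^ (p * (α - 1)) := by linarith
  have hd := (((hasDerivAt_abs_rpow_of_ne_zero (p * (α - 1)) ht).const_mul
    (α ^ p / 2)).const_add 1).rpow_const (p := 1 / p) (Or.inl hB.ne')
  have key : t * deriv (fun t : ℝ => (1 + α ^ p / 2 * |t| ^ (p * (α - 1))) ^ (1 / p)) t /
      (1 + α ^ p / 2 * |t| ^ (p * (α - 1))) ^ (1 / p) =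
      (α - 1) * (α ^ p * |t| ^ (p * (α - 1)) / (2 + α ^ p * |t| ^ (p * (α - 1)))) := by
    rw [hd.deriv, Real.rpow_sub_one hB.ne']
    have hG := (Real.rpow_pos_of_pos hB (1 / p)).ne'
    have hC : 2 + α ^ p * |t| ^ (p * (α - 1)) =
        2 * (1 + α ^ p / 2 * |t| ^ (p * (α - 1))) := by ring
    rw [hC]
    generalize (1 + α ^ p / 2 * |t| ^ (p * (α - 1))) ^ (1 / p) = G at *
    have hB0 := hB.ne'
    generalize 1 + α ^ p / 2 * |t| ^ (p * (α - 1)) = B at *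
    field_simp
  refine ⟨hd.differentiableAt, key, ?_, ?_⟩
  · rw [key]
    have : 0 < α - 1 := by linarith
    positivity
  · rw [key]
    refine mul_lt_of_lt_one_right (by linarith) ?_
    rw [div_lt_one (by linarith)]
    linarith
end

section
/- For every $s \ne 0$ one has $|G^{-1}(s)| \le |G^{-1}(s)\, g(G^{-1}(s))| < \alpha |s|$. -/
open Real Filter MeasureTheory

theorem continuous_one_add_mul_abs_rpow_rpow {c q r : ℝ} (hq : 0 ≤ q) (hr : 0 ≤ r) :
    Continuous fun t : ℝ => (1 + c * |t| ^ q) ^ r :=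
  (continuous_const.add
    (continuous_const.mul (continuous_abs.rpow_const fun _ => .inr hq))).rpow_const
    fun _ => .inr hr

theorem one_le_one_add_mul_abs_rpow_rpow {c q r : ℝ} (hc : 0 ≤ c) (hr : 0 ≤ r) (t : ℝ) :
    1 ≤ (1 + c * |t| ^ q) ^ r :=
  one_le_rpow (le_add_of_nonneg_right (by positivity)) hr

theorem div_rpow_mul_one_add_mul_rpow_rpow_inv {p b c z t : ℝ} (hp : 0 < p) (hc : 0 ≤ c)
    (hz : 0 ≤ z) (ht : 0 < t) :
    (z / t) ^ b * (1 + c * t ^ (p * b)) ^ (1 / p) =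
      ((z / t) ^ (p * b) + c * z ^ (p * b)) ^ (1 / p) := by
  have hzt : 0 ≤ z / t := by positivity
  have h : (z / t) ^ b = ((z / t) ^ (p * b)) ^ (1 / p) := by
    rw [← rpow_mul hzt]
    congr 1
    field_simp
  rw [h, ← mul_rpow (by positivity) (by positivity), div_rpow hz ht.le]
  have : 0 < t ^ (p * b) := by positivity
  congr 1
  field_simp

/-- A growth estimate for the primitive of `z ↦ (1 + c * |z| ^ (p * (a - 1))) ^ (1 / p)`. -/
theorem mul_lt_mul_integral_one_add_mul_abs_rpow {p a c t : ℝ} (hp : 0 < p) (ha : 1 < a)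
    (hc : 0 ≤ c) (ht : 0 < t) :
    t * (1 + c * |t| ^ (p * (a - 1))) ^ (1 / p) <
      a * ∫ z in (0 : ℝ)..t, (1 + c * |z| ^ (p * (a - 1))) ^ (1 / p) := by
  have hb : 0 < a - 1 := sub_pos.2 ha
  have hq : 0 < p * (a - 1) := mul_pos hp hb
  have hp' : 0 < 1 / p := by positivity
  set C := (1 + c * |t| ^ (p * (a - 1))) ^ (1 / p) with hC
  rw [abs_of_pos ht] at hC
  have key : ∫ z in (0 : ℝ)..t, (z / t) ^ (a - 1) * C <
      ∫ z in (0 : ℝ)..t, (1 + c * |z| ^ (p * (a - 1))) ^ (1 / p) := by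
    apply intervalIntegral.integral_lt_integral_of_continuousOn_of_le_of_exists_lt ht
    · exact (((continuous_id.div_const t).rpow_const fun _ => .inr hb.le).mul
        continuous_const).continuousOn
    · exact (continuous_one_add_mul_abs_rpow_rpow hq.le hp'.le).continuousOn
    · rintro z ⟨hz, hzt⟩
      rw [hC, div_rpow_mul_one_add_mul_rpow_rpow_inv hp hc hz.le ht, abs_of_pos hz]
      have : (z / t) ^ (p * (a - 1)) ≤ 1 :=
        rpow_le_one (by positivity) ((div_le_one ht).2 hzt) hq.le
      gcongr
    · refine ⟨0, ⟨le_rfl, ht.le⟩, ?_⟩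
      rw [zero_div, zero_rpow hb.ne', zero_mul]
      positivity
  have hint : ∫ z in (0 : ℝ)..t, (z / t) ^ (a - 1) * C = t * C / a := by
    rw [intervalIntegral.integral_mul_const,
      intervalIntegral.integral_comp_div (fun z : ℝ => z ^ (a - 1)) ht.ne',
      integral_rpow (.inl (by linarith))]
    simp [ht.ne', (zero_lt_one.trans ha).ne']
    ring
  rw [hint, div_lt_iff₀ (by linarith)] at key
  linarith

/-- For every `s ≠ 0`, `|G⁻¹(s)| ≤ |G⁻¹(s) g(G⁻¹(s))| < α |s|`, where
`g t = (1 + α^p/2 * |t|^(p(α-1)))^(1/p)`, `G t = ∫ z in 0..t, g z`,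
`p > 1`, `α > 1`, and `Ginv` is the inverse of `G`. -/
theorem stmt_6 (p α : ℝ) (hp : 1 < p) (hα : 1 < α)
    (g G Ginv : ℝ → ℝ)
    (hg : ∀ t : ℝ, g t = (1 + α ^ p / 2 * |t| ^ (p * (α - 1))) ^ (1 / p))
    (hG : ∀ t : ℝ, G t = ∫ z in (0 : ℝ)..t, g z)
    (hinv₁ : Function.LeftInverse Ginv G)
    (hinv₂ : Function.RightInverse Ginv G) :
    ∀ s : ℝ, s ≠ 0 →
      |Ginv s| ≤ |Ginv s * g (Ginv s)| ∧ |Ginv s * g (Ginv s)| < α * |s| := by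
  intro s hs
  have hp0 : 0 < p := by linarith
  have hc : 0 ≤ α ^ p / 2 := by positivity
  have hone : ∀ t, 1 ≤ g t := fun t => by
    rw [hg]
    exact one_le_one_add_mul_abs_rpow_rpow hc (by positivity) t
  have heven : ∀ t, g (-t) = g t := fun t => by rw [hg, hg, abs_neg]
  have hodd : ∀ t, G (-t) = -G t := fun t => by
    have h := intervalIntegral.integral_comp_neg (a := 0) (b := t) g
    simp only [heven, neg_zero] at h
    rw [hG, hG, h, intervalIntegral.integral_symm]
  have hpos : ∀ t, 0 < t → t * g t < α * G t := fun t ht => by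
    rw [hG, hg, funext hg]
    exact mul_lt_mul_integral_one_add_mul_abs_rpow hp0 hα hc ht
  obtain ⟨t, rfl⟩ : ∃ t, G t = s := ⟨Ginv s, hinv₂ s⟩
  rw [hinv₁ t, abs_mul, abs_of_pos (zero_lt_one.trans_le (hone t))]
  refine ⟨le_mul_of_one_le_right (abs_nonneg t) (hone t), ?_⟩
  have ht : t ≠ 0 := by
    rintro rfl
    exact hs (by simp [hG])
  rcases ht.lt_or_gt with h | h
  · have := hpos (-t) (neg_pos.2 h)
    rw [heven, hodd] at this
    rw [abs_of_neg h]
    exact this.trans_le (by gcongr; exact neg_le_abs _)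
  · rw [abs_of_pos h]
    exact (hpos t h).trans_le (by gcongr; exact le_abs_self _)
end

section
/- Let $\wp$ be a real number and let $t\ne 0$. If $\wp > \alpha$, then $\frac{\wp-\alpha}{g(t)} < \frac{(\wp-1)g(t) - t\,g'(t)}{g(t)^2} \le \wp - 1$; if $1 < \wp < \alpha$, then $\wp - \alpha < \frac{(\wp-1)g(t) - t\,g'(t)}{g(t)^2} \le \wp - 1$. -/
open Real Filter

/-- Euler-type identity for the power function of the absolute value. -/
theorem mul_deriv_one_add_mul_abs_rpow_rpow {c k q t : ℝ} (hc : 0 ≤ c) (ht : t ≠ 0) :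
    t * deriv (fun x : ℝ => (1 + c * |x| ^ k) ^ q) t =
      q * k * (c * |t| ^ k / (1 + c * |t| ^ k)) * (1 + c * |t| ^ k) ^ q := by
  have habs : 0 < |t| := abs_pos.mpr ht
  have hB : 0 < 1 + c * |t| ^ k := by positivity
  have hd := (((hasDerivAt_abs ht).rpow_const (p := k) (Or.inl habs.ne')).const_mul c).const_add 1
    |>.rpow_const (p := q) (Or.inl hB.ne')
  rw [hd.deriv, Real.rpow_sub_one hB.ne', Real.rpow_sub_one habs.ne']
  have hs : t * (SignType.sign t : ℝ) = |t| := self_mul_sign t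
  calc _ = t * (SignType.sign t : ℝ) * (c * (k * (|t| ^ k / |t|))) * q *
        ((1 + c * |t| ^ k) ^ q / (1 + c * |t| ^ k)) := by ring
    _ = _ := by rw [hs]; field_simp

/-- Let `℘ : ℝ` and `t ≠ 0`.  If `℘ > α` then
`(℘-α)/g(t) < ((℘-1)g(t) - t g'(t))/g(t)² ≤ ℘ - 1`; if `1 < ℘ < α` then
`℘ - α < ((℘-1)g(t) - t g'(t))/g(t)² ≤ ℘ - 1`.  Here
`g t = (1 + α^p/2 * |t|^(p(α-1)))^(1/p)`, `p > 1`, `α > 1`. -/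
theorem stmt_7 (p α : ℝ) (hp : 1 < p) (hα : 1 < α)
    (g : ℝ → ℝ)
    (hg : ∀ t : ℝ, g t = (1 + α ^ p / 2 * |t| ^ (p * (α - 1))) ^ (1 / p))
    (wp t : ℝ) (ht : t ≠ 0) :
    (wp > α →
      (wp - α) / g t < ((wp - 1) * g t - t * deriv g t) / (g t) ^ 2 ∧
      ((wp - 1) * g t - t * deriv g t) / (g t) ^ 2 ≤ wp - 1) ∧
    (1 < wp → wp < α →
      wp - α < ((wp - 1) * g t - t * deriv g t) / (g t) ^ 2 ∧
      ((wp - 1) * g t - t * deriv g t) / (g t) ^ 2 ≤ wp - 1) := by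
  have hp0 : 0 < p := by linarith
  have hc : 0 < α ^ p / 2 := by positivity
  have hu : 0 < α ^ p / 2 * |t| ^ (p * (α - 1)) := by
    have := abs_pos.mpr ht
    positivity
  have hder : t * deriv g t = (α - 1) * (α ^ p / 2 * |t| ^ (p * (α - 1)) /
      (1 + α ^ p / 2 * |t| ^ (p * (α - 1)))) * g t := by
    rw [hg t, funext hg, mul_deriv_one_add_mul_abs_rpow_rpow hc.le ht]
    congr 2
    field_simp
  have hg1 : 1 ≤ g t := by
    rw [hg t]
    exact Real.one_le_rpow (by linarith) (by positivity)
  rw [hder]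
  generalize α ^ p / 2 * |t| ^ (p * (α - 1)) = u at hu
  have hs0 : 0 < u / (1 + u) := by positivity
  have hs1 : u / (1 + u) < 1 := by rw [div_lt_one (by positivity)]; linarith
  generalize u / (1 + u) = s at hs0 hs1
  generalize g t = G at hg1
  have hG : 0 < G := by linarith
  have hquot : ((wp - 1) * G - (α - 1) * s * G) / G ^ 2 = (wp - 1 - (α - 1) * s) / G := by
    field_simp
  rw [hquot]
  have hlow : wp - α < wp - 1 - (α - 1) * s := by nlinarith
  have hup : 1 < wp → (wp - 1 - (α - 1) * s) / G ≤ wp - 1 := fun hw => by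
    rw [div_le_iff₀ hG]
    nlinarith
  refine ⟨fun h => ⟨div_lt_div_of_pos_right hlow hG, hup (by linarith)⟩,
    fun h h' => ⟨?_, hup h⟩⟩
  rw [lt_div_iff₀ hG]
  nlinarith
end

section
/- The function $s \mapsto \frac{(G^{-1}(s))^{\alpha}}{s}$ is strictly increasing on $(0,\infty)$. -/
open Real Filter MeasureTheory

lemma intervalIntegral_lt_rpow_mul_of_scaling {g : ℝ → ℝ} {α : ℝ} (hcont : Continuous g)
    (hscale : ∀ c z : ℝ, 1 < c → 0 ≤ z → g (c * z) < c ^ (α - 1) * g z)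
    {a c : ℝ} (ha : 0 < a) (hc : 1 < c) :
    ∫ z in (0 : ℝ)..c * a, g z < c ^ α * ∫ z in (0 : ℝ)..a, g z := by
  have hc0 : 0 < c := by linarith
  have hsub : ∫ z in (0 : ℝ)..c * a, g z = c * ∫ z in (0 : ℝ)..a, g (c * z) := by
    rw [intervalIntegral.mul_integral_comp_mul_left, mul_zero]
  have hlt : ∫ z in (0 : ℝ)..a, g (c * z) < ∫ z in (0 : ℝ)..a, c ^ (α - 1) * g z :=
    intervalIntegral.integral_lt_integral_of_continuousOn_of_le_of_exists_lt ha
      (by fun_prop) (by fun_prop) (fun z hz => (hscale c z hc hz.1.le).le)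
      ⟨a, ⟨ha.le, le_rfl⟩, hscale c a hc ha.le⟩
  rw [intervalIntegral.integral_const_mul] at hlt
  calc ∫ z in (0 : ℝ)..c * a, g z = c * ∫ z in (0 : ℝ)..a, g (c * z) := hsub
    _ < c * (c ^ (α - 1) * ∫ z in (0 : ℝ)..a, g z) := by gcongr
    _ = c ^ α * ∫ z in (0 : ℝ)..a, g z := by
      rw [rpow_sub_one hc0.ne']
      field_simp

lemma one_add_mul_rpow_scaling_lt {p β k c z : ℝ} (hp : 0 < p) (hβ : 0 < β) (hk : 0 ≤ k)
    (hc : 1 < c) :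
    (1 + k * |c * z| ^ (p * β)) ^ (1 / p) < c ^ β * (1 + k * |z| ^ (p * β)) ^ (1 / p) := by
  have hc0 : 0 < c := by linarith
  have hroot : c ^ β = (c ^ (p * β)) ^ (1 / p) := by
    rw [← rpow_mul hc0.le]
    congr 1
    field_simp
  rw [hroot, ← mul_rpow (by positivity) (by positivity)]
  refine rpow_lt_rpow (by positivity) ?_ (by positivity)
  rw [abs_mul, abs_of_pos hc0, mul_rpow hc0.le (abs_nonneg z)]
  have h1 : 1 < c ^ (p * β) := one_lt_rpow hc (by positivity)
  linarith

/-- The function `s ↦ (G⁻¹(s))^α / s` is strictly increasing on `(0,∞)`, where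
`g t = (1 + α^p/2 * |t|^(p(α-1)))^(1/p)`, `G t = ∫ z in 0..t, g z`,
`p > 1`, `α > 1`, and `Ginv` is the inverse of `G`. -/
theorem stmt_8 (p α : ℝ) (hp : 1 < p) (hα : 1 < α)
    (g G Ginv : ℝ → ℝ)
    (hg : ∀ t : ℝ, g t = (1 + α ^ p / 2 * |t| ^ (p * (α - 1))) ^ (1 / p))
    (hG : ∀ t : ℝ, G t = ∫ z in (0 : ℝ)..t, g z)
    (hinv₁ : Function.LeftInverse Ginv G)
    (hinv₂ : Function.RightInverse Ginv G) :
    StrictMonoOn (fun s : ℝ => (Ginv s) ^ α / s) (Set.Ioi (0 : ℝ)) := by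
  have hp0 : 0 < p := by linarith
  have hα0 : 0 < α := by linarith
  have hβ : 0 < α - 1 := by linarith
  have hcont : Continuous g := by
    rw [funext hg]
    refine Continuous.rpow_const ?_ fun _ => Or.inr (by positivity)
    exact continuous_const.add (continuous_const.mul
      (continuous_abs.rpow_const fun _ => Or.inr (by positivity)))
  have hnonneg : ∀ t, 0 ≤ g t := fun t => by rw [hg]; positivity
  have hscale : ∀ c z : ℝ, 1 < c → 0 ≤ z → g (c * z) < c ^ (α - 1) * g z := by
    intro c z hc _
    rw [hg, hg]
    exact one_add_mul_rpow_scaling_lt hp0 hβ (by positivity) hc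
  have hmono : Monotone G := by
    intro a b hab
    have hsub := intervalIntegral.integral_interval_sub_left
      (hcont.intervalIntegrable (μ := volume) 0 b) (hcont.intervalIntegrable 0 a)
    have hab0 := intervalIntegral.integral_nonneg (μ := volume) hab fun t _ => hnonneg t
    rw [hG, hG]
    linarith
  have hG0 : G 0 = 0 := by simp [hG]
  have hlt : ∀ {x y}, x < y → Ginv x < Ginv y := fun {x y} hxy =>
    hmono.reflect_lt (by rwa [hinv₂ x, hinv₂ y])
  intro s hs t ht hst
  have hs0 : 0 < s := hs
  have ht0 : 0 < t := ht
  have ha : 0 < Ginv s := hmono.reflect_lt (by rwa [hinv₂ s, hG0])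
  have hab := hlt hst
  have hc : 1 < Ginv t / Ginv s := (one_lt_div ha).2 hab
  have key := intervalIntegral_lt_rpow_mul_of_scaling hcont hscale ha hc
  rw [div_mul_cancel₀ _ ha.ne', ← hG, ← hG, hinv₂, hinv₂,
    div_rpow (ha.trans hab).le ha.le, div_mul_eq_mul_div,
    lt_div_iff₀ (rpow_pos_of_pos ha α)] at key
  change Ginv s ^ α / s < Ginv t ^ α / t
  rw [div_lt_div_iff₀ hs0 ht0]
  linarith
end

section
/- For every $s \in \mathbb{R}$ one has $|G^{-1}(s)|^{\alpha} \le 2^{1/p}\,|s|$. -/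
open Real Filter MeasureTheory

/-- The weight `(1 + α^p/2 * |t|^(p(α-1)))^(1/p)` is continuous. -/
theorem continuous_weight {p α : ℝ} (hp : 1 < p) (hα : 1 < α) :
    Continuous fun t : ℝ => (1 + α ^ p / 2 * |t| ^ (p * (α - 1))) ^ (1 / p) := by
  have hp0 : 0 < p := by linarith
  have hexp : 0 ≤ p * (α - 1) := mul_nonneg hp0.le (by linarith)
  have hp' : 0 ≤ 1 / p := by positivity
  exact (continuous_const.add (continuous_const.mul
    (continuous_abs.rpow_const fun _ => Or.inr hexp))).rpow_const fun _ => Or.inr hp'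

/-- Dropping the `1` in the weight gives a pointwise power lower bound. -/
theorem mul_rpow_le_weight {p α z : ℝ} (hp : 1 < p) (hα : 1 < α) (hz : 0 ≤ z) :
    α * z ^ (α - 1) ≤
      (2 : ℝ) ^ (1 / p) * (1 + α ^ p / 2 * |z| ^ (p * (α - 1))) ^ (1 / p) := by
  have hp0 : 0 < p := by linarith
  have hα0 : 0 < α := by linarith
  have hw : 0 ≤ z ^ (α - 1) := rpow_nonneg hz _
  rw [abs_of_nonneg hz, ← mul_rpow (by norm_num) (by positivity), one_div,
    le_rpow_inv_iff_of_pos (by positivity) (by positivity) hp0, mul_rpow hα0.le hw,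
    ← rpow_mul hz, mul_comm (α - 1) p]
  linarith

theorem rpow_le_mul_integral_weight {p α t : ℝ} (hp : 1 < p) (hα : 1 < α) (ht : 0 ≤ t) :
    t ^ α ≤ (2 : ℝ) ^ (1 / p) *
      ∫ z in (0 : ℝ)..t, (1 + α ^ p / 2 * |z| ^ (p * (α - 1))) ^ (1 / p) := by
  have hα0 : α ≠ 0 := by linarith
  have hpow : ∫ z in (0 : ℝ)..t, α * z ^ (α - 1) = t ^ α := by
    rw [intervalIntegral.integral_const_mul, integral_rpow (Or.inl (by linarith)),
      sub_add_cancel, zero_rpow hα0, sub_zero, mul_div_cancel₀ _ hα0]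
  rw [← hpow, ← intervalIntegral.integral_const_mul]
  refine intervalIntegral.integral_mono_on ht
    ((intervalIntegral.intervalIntegrable_rpow' (by linarith)).const_mul _)
    ((continuous_const.mul (continuous_weight hp hα)).intervalIntegrable _ _)
    fun z hz => mul_rpow_le_weight hp hα hz.1

/-- For every `s : ℝ`, `|G⁻¹(s)|^α ≤ 2^(1/p) |s|`, where
`g t = (1 + α^p/2 * |t|^(p(α-1)))^(1/p)`, `G t = ∫ z in 0..t, g z`,
`p > 1`, `α > 1`, and `Ginv` is the inverse of `G`. -/
theorem stmt_9 (p α : ℝ) (hp : 1 < p) (hα : 1 < α)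
    (g G Ginv : ℝ → ℝ)
    (hg : ∀ t : ℝ, g t = (1 + α ^ p / 2 * |t| ^ (p * (α - 1))) ^ (1 / p))
    (hG : ∀ t : ℝ, G t = ∫ z in (0 : ℝ)..t, g z)
    (hinv₁ : Function.LeftInverse Ginv G)
    (hinv₂ : Function.RightInverse Ginv G) :
    ∀ s : ℝ, |Ginv s| ^ α ≤ (2 : ℝ) ^ (1 / p) * |s| := by
  have hodd : ∀ t, G (-t) = -G t := fun t => by
    have h := intervalIntegral.integral_comp_neg (a := 0) (b := t) g
    have heven : ∀ z, g (-z) = g z := fun z => by rw [hg, hg, abs_neg]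
    simp only [heven, neg_zero] at h
    rw [hG, hG, h, intervalIntegral.integral_symm]
  have habs : ∀ t, |G (|t|)| = |G t| := fun t => by
    rcases abs_choice t with h | h <;> rw [h]
    rw [hodd, abs_neg]
  intro s
  have h := rpow_le_mul_integral_weight hp hα (abs_nonneg (Ginv s))
  simp only [← hg] at h
  rw [← hG] at h
  calc |Ginv s| ^ α ≤ (2 : ℝ) ^ (1 / p) * G |Ginv s| := h
    _ ≤ (2 : ℝ) ^ (1 / p) * |G (|Ginv s|)| := by gcongr; exact le_abs_self _
    _ = (2 : ℝ) ^ (1 / p) * |s| := by rw [habs, hinv₂ s]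
end

section
/- For every $s \in \mathbb{R}$ with $|s| \ge 1$ one has $|G^{-1}(s)|^{\alpha} \ge (G^{-1}(1))^{\alpha}\, |s|$. -/
open Real Filter MeasureTheory

/-- A function `z ↦ (1 + c |z|^(p(α-1)))^(1/p)` grows under dilation by `l ≥ 1` at most by the
factor `l^(α-1)`. -/
lemma rpow_one_add_dilation_le {p α c l : ℝ} (hp : 0 < p) (hα : 1 ≤ α) (hc : 0 ≤ c) (hl : 1 ≤ l)
    (z : ℝ) :
    (1 + c * |l * z| ^ (p * (α - 1))) ^ (1 / p) ≤
      l ^ (α - 1) * (1 + c * |z| ^ (p * (α - 1))) ^ (1 / p) := by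
  have hl0 : 0 ≤ l := by linarith
  have hx : 0 ≤ |z| ^ (p * (α - 1)) := by positivity
  have hpow : l ^ (α - 1) = (l ^ (p * (α - 1))) ^ (1 / p) := by
    rw [← rpow_mul hl0]
    congr 1
    field_simp
  have hone : 1 ≤ l ^ (p * (α - 1)) :=
    one_le_rpow hl (mul_nonneg hp.le (by linarith))
  rw [hpow, ← mul_rpow (by positivity) (by positivity), abs_mul, abs_of_nonneg hl0,
    mul_rpow hl0 (abs_nonneg z)]
  refine rpow_le_rpow (by positivity) ?_ (by positivity)
  nlinarith

/-- The primitive from `0` of a continuous function satisfying `g (l z) ≤ l^(α-1) g z` for some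
`l > 0` satisfies `G (l t) ≤ l^α G t` on `t ≥ 0`. -/
lemma integral_dilation_le {g : ℝ → ℝ} (hg : Continuous g) {α l t : ℝ} (hl : 0 < l) (ht : 0 ≤ t)
    (h : ∀ z, g (l * z) ≤ l ^ (α - 1) * g z) :
    ∫ z in (0 : ℝ)..l * t, g z ≤ l ^ α * ∫ z in (0 : ℝ)..t, g z := by
  have hsub : ∫ z in (0 : ℝ)..l * t, g z = l * ∫ z in (0 : ℝ)..t, g (l * z) := by
    rw [intervalIntegral.mul_integral_comp_mul_left, mul_zero]
  have hmono : ∫ z in (0 : ℝ)..t, g (l * z) ≤ ∫ z in (0 : ℝ)..t, l ^ (α - 1) * g z :=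
    intervalIntegral.integral_mono ht
      ((hg.comp (continuous_const_mul l)).intervalIntegrable _ _)
      ((hg.const_mul _).intervalIntegrable _ _) h
  rw [intervalIntegral.integral_const_mul] at hmono
  calc _ ≤ l * (l ^ (α - 1) * ∫ z in (0 : ℝ)..t, g z) := by
        rw [hsub]; exact mul_le_mul_of_nonneg_left hmono hl.le
    _ = _ := by
        rw [← mul_assoc, rpow_sub_one hl.ne']
        field_simp

/-- For every `s : ℝ` with `|s| ≥ 1`, `|G⁻¹(s)|^α ≥ (G⁻¹(1))^α |s|`, where
`g t = (1 + α^p/2 * |t|^(p(α-1)))^(1/p)`, `G t = ∫ z in 0..t, g z`,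
`p > 1`, `α > 1`, and `Ginv` is the inverse of `G`. -/
theorem stmt_10 (p α : ℝ) (hp : 1 < p) (hα : 1 < α)
    (g G Ginv : ℝ → ℝ)
    (hg : ∀ t : ℝ, g t = (1 + α ^ p / 2 * |t| ^ (p * (α - 1))) ^ (1 / p))
    (hG : ∀ t : ℝ, G t = ∫ z in (0 : ℝ)..t, g z)
    (hinv₁ : Function.LeftInverse Ginv G)
    (hinv₂ : Function.RightInverse Ginv G) :
    ∀ s : ℝ, 1 ≤ |s| → (Ginv 1) ^ α * |s| ≤ |Ginv s| ^ α := by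
  have hp0 : 0 < p := by linarith
  have hα0 : 0 < α := by linarith
  have hg0 (t : ℝ) : 0 ≤ g t := by rw [hg]; positivity
  have hcont : Continuous g := by
    rw [funext hg]
    have h1 : 0 ≤ p * (α - 1) := mul_nonneg hp0.le (by linarith)
    have h2 : 0 ≤ 1 / p := by positivity
    exact (continuous_const.add (continuous_const.mul
      (continuous_abs.rpow_const fun _ => Or.inr h1))).rpow_const fun _ => Or.inr h2
  have hmono : Monotone G := by
    intro a b hab
    have h := intervalIntegral.integral_interval_sub_left
      (hcont.intervalIntegrable (μ := volume) 0 b) (hcont.intervalIntegrable 0 a)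
    have h' := intervalIntegral.integral_nonneg (μ := volume) hab fun u _ => hg0 u
    rw [hG, hG]
    linarith
  have hzero : G 0 = 0 := by rw [hG, intervalIntegral.integral_same]
  have hodd (t : ℝ) : G (-t) = -G t := by
    have heven : (fun z => g (-z)) = g := by
      funext z
      rw [hg, hg, abs_neg]
    have h := intervalIntegral.integral_comp_neg (a := 0) (b := t) g
    simp only [heven, neg_zero] at h
    rw [hG, hG, h, intervalIntegral.integral_symm]
  have habs (t : ℝ) : G |t| = |G t| := by
    rcases le_total 0 t with ht | ht
    · rw [abs_of_nonneg ht, abs_of_nonneg (hzero ▸ hmono ht)]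
    · rw [abs_of_nonpos ht, abs_of_nonpos (hzero ▸ hmono ht), hodd]
  intro s hs
  have hG1 : G (Ginv 1) = 1 := hinv₂ 1
  have hGs : G |Ginv s| = |s| := by rw [habs, hinv₂ s]
  have hpos : 0 < Ginv 1 := by
    by_contra! h
    have := hmono h
    linarith
  have hle : Ginv 1 ≤ |Ginv s| := by
    by_contra! h
    have h1 : G |Ginv s| = 1 := le_antisymm (hG1 ▸ hmono h.le) (hGs ▸ hs)
    have h2 := hinv₁ |Ginv s|
    rw [h1] at h2
    exact h.ne' h2
  have hl : 1 ≤ |Ginv s| / Ginv 1 := (one_le_div hpos).2 hle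
  have key := integral_dilation_le hcont (α := α) (l := |Ginv s| / Ginv 1) (by linarith) hpos.le
    fun z => by
      rw [hg, hg]
      exact rpow_one_add_dilation_le hp0 hα.le (by positivity) hl z
  rw [← hG, ← hG, div_mul_cancel₀ _ hpos.ne', hGs, hG1, mul_one,
    div_rpow (abs_nonneg _) hpos.le, le_div_iff₀ (rpow_pos_of_pos hpos α)] at key
  rwa [mul_comm]
end

section
/- Let $k$ be a real number with $k > \alpha$. Then there exists a constant $c > 0$ such that for every $s > 0$, $\frac{(G^{-1}(s))^{k-1}}{g(G^{-1}(s))} \le c\, s^{(k-\alpha)/\alpha}$; one may take $c = \frac{2^{1/p}}{\alpha}\, 2^{(k-\alpha)/(\alpha p)}$. -/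
open Real Filter MeasureTheory

theorem mul_rpow_le_one_add_rpow {p α t : ℝ} (hp : 1 < p) (hα : 1 < α) (ht : 0 ≤ t) :
    α / (2 : ℝ) ^ (1 / p) * t ^ (α - 1) ≤
      (1 + α ^ p / 2 * |t| ^ (p * (α - 1))) ^ (1 / p) := by
  have hp0 : p ≠ 0 := by positivity
  have hα0 : 0 ≤ α := by linarith
  have heq : α / (2 : ℝ) ^ (1 / p) * t ^ (α - 1) =
      (α ^ p / 2 * |t| ^ (p * (α - 1))) ^ (1 / p) := by
    rw [abs_of_nonneg ht, mul_rpow (by positivity) (by positivity),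
      div_rpow (by positivity) (by positivity), ← rpow_mul hα0, ← rpow_mul ht,
      mul_one_div_cancel hp0, rpow_one]
    congr 2
    field_simp
  rw [heq]
  apply rpow_le_rpow (by positivity) (by linarith) (by positivity)

theorem rpow_div_le_integral {p α t : ℝ} (hp : 1 < p) (hα : 1 < α) (ht : 0 ≤ t) :
    t ^ α / (2 : ℝ) ^ (1 / p) ≤
      ∫ z in (0 : ℝ)..t, (1 + α ^ p / 2 * |z| ^ (p * (α - 1))) ^ (1 / p) := by
  have hint : ∫ z in (0 : ℝ)..t, α / (2 : ℝ) ^ (1 / p) * z ^ (α - 1) =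
      t ^ α / (2 : ℝ) ^ (1 / p) := by
    rw [intervalIntegral.integral_const_mul, integral_rpow (Or.inl (by linarith)),
      sub_add_cancel, zero_rpow (by linarith)]
    field_simp
    ring
  have hexp : 0 ≤ p * (α - 1) := mul_nonneg (by linarith) (by linarith)
  rw [← hint]
  refine intervalIntegral.integral_mono_on ht ?_ ?_
    fun z hz => mul_rpow_le_one_add_rpow hp hα hz.1
  · exact (continuous_const.mul
      (continuous_id.rpow_const fun _ => Or.inr (by linarith))).intervalIntegrable _ _
  · exact ((continuous_const.add (continuous_const.mul
      (continuous_abs.rpow_const fun _ => Or.inr hexp))).rpow_const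
        fun _ => Or.inr (by positivity)).intervalIntegrable _ _

/-- Let `k > α`.  Then there is a constant `c > 0` such that for every `s > 0`,
`(G⁻¹(s))^(k-1) / g(G⁻¹(s)) ≤ c s^((k-α)/α)`; one may take
`c = (2^(1/p)/α) · 2^((k-α)/(αp))`.  Here
`g t = (1 + α^p/2 * |t|^(p(α-1)))^(1/p)`, `G t = ∫ z in 0..t, g z`,
`p > 1`, `α > 1`, and `Ginv` is the inverse of `G`. -/
theorem stmt_12 (p α : ℝ) (hp : 1 < p) (hα : 1 < α)
    (g G Ginv : ℝ → ℝ)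
    (hg : ∀ t : ℝ, g t = (1 + α ^ p / 2 * |t| ^ (p * (α - 1))) ^ (1 / p))
    (hG : ∀ t : ℝ, G t = ∫ z in (0 : ℝ)..t, g z)
    (hinv₁ : Function.LeftInverse Ginv G)
    (hinv₂ : Function.RightInverse Ginv G)
    (k : ℝ) (hk : α < k) :
    ∃ c : ℝ, 0 < c ∧ c = (2 : ℝ) ^ (1 / p) / α * (2 : ℝ) ^ ((k - α) / (α * p)) ∧
      ∀ s : ℝ, 0 < s →
        (Ginv s) ^ (k - 1) / g (Ginv s) ≤ c * s ^ ((k - α) / α) := by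
  refine ⟨_, by positivity, rfl, fun s hs => ?_⟩
  have hα0 : 0 < α := by linarith
  have hGt : G (Ginv s) = s := hinv₂ s
  set t := Ginv s
  have hg0 : ∀ z, 0 ≤ g z := fun z => by rw [hg]; positivity
  have ht : 0 < t := by
    by_contra! h
    have hneg : G t ≤ 0 := by
      rw [hG, intervalIntegral.integral_symm, neg_nonpos]
      exact intervalIntegral.integral_nonneg h fun z _ => hg0 z
    linarith
  have hgt : α / (2 : ℝ) ^ (1 / p) * t ^ (α - 1) ≤ g t := by
    rw [hg]
    exact mul_rpow_le_one_add_rpow hp hα ht.le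
  have hts : t ^ α ≤ (2 : ℝ) ^ (1 / p) * s := by
    have h := rpow_div_le_integral hp hα ht.le
    simp_rw [← hg] at h
    rw [← hG, hGt, div_le_iff₀ (by positivity)] at h
    linarith
  have hpow : t ^ (k - α) ≤ (2 : ℝ) ^ ((k - α) / (α * p)) * s ^ ((k - α) / α) := by
    have h := rpow_le_rpow (by positivity) hts
      (div_nonneg (sub_nonneg.2 hk.le) hα0.le)
    rwa [mul_rpow (by positivity) hs.le, ← rpow_mul ht.le, ← rpow_mul (by norm_num),
      mul_div_cancel₀ _ hα0.ne', div_mul_div_comm, one_mul, mul_comm p α] at h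
  calc t ^ (k - 1) / g t
      ≤ t ^ (k - 1) / (α / (2 : ℝ) ^ (1 / p) * t ^ (α - 1)) := by gcongr
    _ = (2 : ℝ) ^ (1 / p) / α * t ^ (k - α) := by
        rw [show k - 1 = (k - α) + (α - 1) by ring, rpow_add ht]
        field_simp
    _ ≤ (2 : ℝ) ^ (1 / p) / α *
          ((2 : ℝ) ^ ((k - α) / (α * p)) * s ^ ((k - α) / α)) := by gcongr
    _ = _ := by ring
end

section
/- For every $t \ne 0$, the derivative of the map $t \mapsto t\,g(t)$ satisfies $1 \le \frac{d}{dt}\bigl(t\,g(t)\bigr) \,/\, g(t) = 1 + \frac{t\,g'(t)}{g(t)} < \alpha$; equivalently, $g(t) \le g(t) + t\,g'(t) < \alpha\, g(t)$ for all $t \ne 0$. -/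
open Real Filter

/-- The Euler operator `t d/dt` applied to `(1 + c |t| ^ q) ^ r`, away from the origin. -/
lemma exists_hasDerivAt_one_add_abs_rpow_rpow {c q r t : ℝ} (hc : 0 ≤ c) (ht : t ≠ 0) :
    ∃ d, HasDerivAt (fun x : ℝ => (1 + c * |x| ^ q) ^ r) d t ∧
      t * d = q * r * (c * |t| ^ q / (1 + c * |t| ^ q)) * (1 + c * |t| ^ q) ^ r := by
  have habs : 0 < |t| := abs_pos.mpr ht
  have hu : 0 < 1 + c * |t| ^ q := by positivity
  refine ⟨_, ((((hasDerivAt_abs ht).rpow_const (p := q) (Or.inl habs.ne')).const_mul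
    c).const_add 1).rpow_const (p := r) (Or.inl hu.ne'), ?_⟩
  have hs : t * (SignType.sign t : ℝ) = |t| := self_mul_sign t
  rw [rpow_sub_one hu.ne', rpow_sub_one habs.ne']
  calc _ = (t * (SignType.sign t : ℝ)) / |t| * (q * r * (c * |t| ^ q / (1 + c * |t| ^ q)) *
        (1 + c * |t| ^ q) ^ r) := by ring
    _ = _ := by rw [hs, div_self habs.ne', one_mul]

/-- For every `t ≠ 0`, the derivative of `t ↦ t g(t)` satisfies
`1 ≤ (d/dt)(t g(t)) / g(t) = 1 + t g'(t)/g(t) < α`; equivalently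
`g(t) ≤ g(t) + t g'(t) < α g(t)`.  Here
`g t = (1 + α^p/2 * |t|^(p(α-1)))^(1/p)`, `p > 1`, `α > 1`. -/
theorem stmt_14 (p α : ℝ) (hp : 1 < p) (hα : 1 < α)
    (g : ℝ → ℝ)
    (hg : ∀ t : ℝ, g t = (1 + α ^ p / 2 * |t| ^ (p * (α - 1))) ^ (1 / p)) :
    ∀ t : ℝ, t ≠ 0 →
      deriv (fun t : ℝ => t * g t) t / g t = 1 + t * deriv g t / g t ∧
      1 ≤ 1 + t * deriv g t / g t ∧ 1 + t * deriv g t / g t < α ∧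
      g t ≤ g t + t * deriv g t ∧ g t + t * deriv g t < α * g t := by
  intro t ht
  have hα0 : 0 < α := by linarith
  have hα1 : 0 < α - 1 := by linarith
  have hp0 : p ≠ 0 := by linarith
  have hc : 0 ≤ α ^ p / 2 := by positivity
  obtain ⟨d, hd, htd⟩ := exists_hasDerivAt_one_add_abs_rpow_rpow (q := p * (α - 1))
    (r := 1 / p) hc ht
  rw [← funext hg] at hd
  rw [← hg, show p * (α - 1) * (1 / p) = α - 1 by field_simp] at htd
  have hw : 0 ≤ α ^ p / 2 * |t| ^ (p * (α - 1)) := by positivity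
  have hgpos : 0 < g t := by rw [hg]; positivity
  set w := α ^ p / 2 * |t| ^ (p * (α - 1))
  have hfrac0 : 0 ≤ w / (1 + w) := by positivity
  have hfrac1 : w / (1 + w) < 1 := (div_lt_one (by linarith)).mpr (by linarith)
  have hratio : t * d / g t = (α - 1) * (w / (1 + w)) := by
    rw [htd, mul_div_cancel_right₀ _ hgpos.ne']
  have hlower : 0 ≤ t * d / g t := by rw [hratio]; positivity
  have hupper : t * d / g t < α - 1 := by
    rw [hratio]; exact mul_lt_of_lt_one_right hα1 hfrac1
  have hderiv : deriv (fun t : ℝ => t * g t) t = g t + t * d := by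
    simpa using ((hasDerivAt_id' t).fun_mul hd).deriv
  rw [hderiv, hd.deriv]
  have hmul : t * d < (α - 1) * g t := (div_lt_iff₀ hgpos).mp hupper
  have hnonneg : 0 ≤ t * d := by rw [htd]; positivity
  exact ⟨by rw [add_div, div_self hgpos.ne'], by linarith, by linarith, by linarith,
    by linarith⟩
end
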